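/- Let θ : W → W be a group automorphism mapping S onto itself with θ ∘ θ = id. If 𝒦 ⊆ W is a quasiparabolic θ-twisted conjugacy class, then θ(x) = x⁻¹ for every x ∈ 𝒦; that is, 𝒦 consists of twisted involutions. -/

import Mathlib

noncomputable section

variable {B W : Type*} [Group W] {M : CoxeterMatrix B}

/-- The `θ`-twisted conjugation action of `W` on itself: `w • x = w·x·θ(w)⁻¹`. -/
def twConj (θ : W ≃* W) (w x : W) : W := w * x * (θ w)⁻¹

/-- The height function `ht = ℓ/2` on `W`. -/
def htL (cs : CoxeterSystem M W) (x : W) : ℚ := (cs.length x : ℚ) / 2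

/-- `𝒦` is a `θ`-twisted conjugacy class, i.e. an orbit of the twisted conjugation action. -/
def IsTwClass (θ : W ≃* W) (𝒦 : Set W) : Prop :=
  ∃ x₀ : W, 𝒦 = Set.range fun w => twConj θ w x₀

/-- The `θ`-twisted conjugacy class `𝒦` is quasiparabolic with respect to the height
function `ht = ℓ/2`: (QP1) and (QP2) hold. -/
def IsQPClass (cs : CoxeterSystem M W) (θ : W ≃* W) (𝒦 : Set W) : Prop :=
  (∀ r : W, cs.IsReflection r → ∀ x ∈ 𝒦,
      htL cs (twConj θ r x) = htL cs x → twConj θ r x = x) ∧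
  (∀ r : W, cs.IsReflection r → ∀ x ∈ 𝒦, ∀ i : B,
      htL cs x < htL cs (twConj θ r x) →
      htL cs (twConj θ (cs.simple i) (twConj θ r x)) < htL cs (twConj θ (cs.simple i) x) →
      twConj θ r x = twConj θ (cs.simple i) x)

/-- `x` is a `W`-minimal element: `ℓ(s·x·θ(s)⁻¹) ≥ ℓ(x)` for all simple reflections `s`. -/
def TwMin (cs : CoxeterSystem M W) (θ : W ≃* W) (x : W) : Prop :=
  ∀ i : B, cs.length x ≤ cs.length (twConj θ (cs.simple i) x)

/-- The automorphism `θ` maps the set `S` of simple reflections onto itself. -/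
def SimpleOnto (cs : CoxeterSystem M W) (θ : W ≃* W) : Prop :=
  ⇑θ '' Set.range cs.simple = Set.range cs.simple

section InversionParity

open CoxeterSystem Classical

/-- The generator `s i` acting on pairs (element, sign): it conjugates the element and flips the
sign exactly when the element is `s i` itself. -/
def signedConj (cs : CoxeterSystem M W) (i : B) : Function.End (W × ZMod 2) :=
  fun p => (cs.simple i * p.1 * cs.simple i, p.2 + if p.1 = cs.simple i then 1 else 0)

theorem prod_map_signedConj (cs : CoxeterSystem M W) (ω : List B) (p : W × ZMod 2) :
    (ω.map (signedConj cs)).prod p =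
      (cs.wordProd ω * p.1 * (cs.wordProd ω)⁻¹,
        p.2 + ((cs.leftInvSeq ω.reverse).count p.1 : ℕ)) := by
  induction ω with
  | nil => simp [Function.End.one_def]
  | cons i ω ih =>
    rw [List.map_cons, List.prod_cons]
    change signedConj cs i ((ω.map (signedConj cs)).prod p) = _
    rw [ih]
    have hiff : cs.wordProd ω * (p.1 * (cs.wordProd ω)⁻¹) = cs.simple i ↔
        (cs.wordProd ω)⁻¹ * (cs.simple i * cs.wordProd ω) = p.1 := by
      constructor
      · intro h; rw [← h]; group
      · intro h; rw [← h]; group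
    have hrev : (i :: ω).reverse = ω.reverse.concat i := by simp
    rw [hrev, leftInvSeq_concat]
    simp [signedConj, hiff, wordProd_cons, mul_assoc, List.count_append, List.count_singleton,
      add_assoc]

theorem reverse_alternatingWord_two_mul (i j : B) (p : ℕ) :
    (alternatingWord i j (2 * p)).reverse = alternatingWord j i (2 * p) := by
  apply List.ext_getElem
  · simp
  · intro k h₁ h₂
    have hk : k < 2 * p := by simpa using h₂
    rw [List.getElem_reverse, getElem_alternatingWord _ _ _ _ hk,
      getElem_alternatingWord _ _ _ _ (by simp; omega)]
    have : Even (2 * p + ((alternatingWord i j (2 * p)).length - 1 - k)) ↔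
        ¬ Even (2 * p + k) := by
      simp only [length_alternatingWord, Nat.even_iff]; omega
    by_cases h : Even (2 * p + k)
    · rw [if_neg (by rwa [this, not_not]), if_pos h]
    · rw [if_pos (this.2 h), if_neg h]

theorem count_leftInvSeq_alternatingWord_even (cs : CoxeterSystem M W) (i j : B) (t : W) :
    Even ((cs.leftInvSeq (alternatingWord i j (2 * M i j))).count t) := by
  set m := M i j with hm
  set L := cs.leftInvSeq (alternatingWord i j (2 * m)) with hL
  have hlen : L.length = 2 * m := by simp [hL]
  have htd : L.drop m = L.take m := by
    apply List.ext_getElem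
    · simp [hlen]; omega
    · intro k h₁ h₂
      have hk : k < m := by simp at h₂; omega
      rw [List.getElem_drop, List.getElem_take]
      rw [cs.getElem_leftInvSeq_alternatingWord i j m (m + k) (by omega),
        cs.getElem_leftInvSeq_alternatingWord i j m k (by omega),
        prod_alternatingWord_eq_mul_pow, prod_alternatingWord_eq_mul_pow]
      have e₁ : (2 * (m + k) + 1) / 2 = m + k := by omega
      have e₂ : (2 * k + 1) / 2 = k := by omega
      have hpow : (cs.simple j * cs.simple i) ^ m = 1 := by
        rw [hm, cs.simple_mul_simple_pow']
      simp [e₁, e₂, pow_add, hpow]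
  rw [← List.take_append_drop m L, htd, List.count_append]
  exact ⟨_, rfl⟩

theorem signedConj_mul_pow (cs : CoxeterSystem M W) (i j : B) (m : ℕ) :
    (signedConj cs i * signedConj cs j) ^ m =
      ((alternatingWord i j (2 * m)).map (signedConj cs)).prod := by
  induction m with
  | zero => simp [alternatingWord]
  | succ m ih =>
    have : alternatingWord i j (2 * (m + 1)) = i :: j :: alternatingWord i j (2 * m) := by
      rw [show 2 * (m + 1) = 2 * m + 1 + 1 by ring, alternatingWord_succ', alternatingWord_succ']
      simp
    rw [this, pow_succ', ih]
    simp [mul_assoc]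

theorem isLiftable_signedConj (cs : CoxeterSystem M W) : M.IsLiftable (signedConj cs) := by
  intro i j
  rw [signedConj_mul_pow]
  funext p
  rw [prod_map_signedConj, reverse_alternatingWord_two_mul]
  have hw : cs.wordProd (alternatingWord i j (2 * M i j)) = 1 := by
    simp [prod_alternatingWord_eq_mul_pow]
  have hc := count_leftInvSeq_alternatingWord_even cs j i p.1
  rw [M.symmetric j i] at hc
  rw [hw, (ZMod.natCast_eq_zero_iff_even).2 hc]
  simp [Function.End.one_def]

/-- The parity of the multiplicity of `t` in the left inversion sequence of a word depends only on
the product of the word. -/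
theorem count_leftInvSeq_parity (cs : CoxeterSystem M W) {ω ω' : List B}
    (h : cs.wordProd ω = cs.wordProd ω') (t : W) :
    ((cs.leftInvSeq ω).count t : ZMod 2) = ((cs.leftInvSeq ω').count t : ZMod 2) := by
  have key (υ : List B) : cs.lift ⟨_, isLiftable_signedConj cs⟩ (cs.wordProd υ) =
      (υ.map (signedConj cs)).prod := by
    simp only [wordProd, map_list_prod, List.map_map]
    congr 2
    funext i
    exact cs.lift_apply_simple (isLiftable_signedConj cs) i
  have hinv : cs.wordProd ω.reverse = cs.wordProd ω'.reverse := by simp [h]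
  have := congrArg (fun f : Function.End (W × ZMod 2) => (f (t, 0)).2)
    ((key ω.reverse).symm.trans ((congrArg _ hinv).trans (key ω'.reverse)))
  simpa only [prod_map_signedConj, List.reverse_reverse, zero_add] using this

theorem wordProd_eq_one_of_even_count (cs : CoxeterSystem M W) {ω : List B}
    (h : ∀ t, Even ((cs.leftInvSeq ω).count t)) : cs.wordProd ω = 1 := by
  obtain ⟨ω', hred, hω'⟩ := cs.exists_isReduced (cs.wordProd ω)
  have hnil : cs.leftInvSeq ω' = [] := by
    refine List.eq_nil_iff_forall_not_mem.2 fun t ht => ?_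
    have h₁ := List.count_eq_one_of_mem hred.nodup_leftInvSeq ht
    have h₂ := count_leftInvSeq_parity cs hω' t
    rw [h₁, (ZMod.natCast_eq_zero_iff_even).2 (h t)] at h₂
    simp at h₂
  have hlen : ω'.length = 0 := by rw [← cs.length_leftInvSeq ω', hnil]; rfl
  rw [hω', List.length_eq_zero_iff.1 hlen, wordProd_nil]

theorem leftInvSeq_append (cs : CoxeterSystem M W) (ω ω' : List B) :
    cs.leftInvSeq (ω ++ ω') =
      cs.leftInvSeq ω ++ (cs.leftInvSeq ω').map (MulAut.conj (cs.wordProd ω)) := by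
  induction ω with
  | nil => simp [leftInvSeq]
  | cons i ω ih => simp [leftInvSeq, ih, wordProd_cons]

end InversionParity

section TwistedConjugation

open CoxeterSystem Classical

theorem twConj_mul (θ : W ≃* W) (u v x : W) :
    twConj θ (u * v) x = twConj θ u (twConj θ v x) := by
  simp [twConj, mul_assoc]

theorem twConj_one (θ : W ≃* W) (x : W) : twConj θ 1 x = x := by simp [twConj]

theorem twConj_simple_simple (cs : CoxeterSystem M W) (θ : W ≃* W) (i : B) (x : W) :
    twConj θ (cs.simple i) (twConj θ (cs.simple i) x) = x := by
  rw [← twConj_mul, cs.simple_mul_simple_self, twConj_one]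

theorem IsTwClass.twConj_mem {θ : W ≃* W} {𝒦 : Set W} (hK : IsTwClass θ 𝒦) {x : W}
    (hx : x ∈ 𝒦) (w : W) : twConj θ w x ∈ 𝒦 := by
  obtain ⟨x₀, rfl⟩ := hK
  obtain ⟨v, rfl⟩ := hx
  exact ⟨w * v, twConj_mul θ w v x₀⟩

theorem IsTwClass.exists_twConj_eq {θ : W ≃* W} {𝒦 : Set W} (hK : IsTwClass θ 𝒦) {x y : W}
    (hx : x ∈ 𝒦) (hy : y ∈ 𝒦) : ∃ w, twConj θ w x = y := by
  obtain ⟨x₀, rfl⟩ := hK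
  obtain ⟨v, rfl⟩ := hx
  obtain ⟨u, rfl⟩ := hy
  exact ⟨u * v⁻¹, by rw [← twConj_mul]; simp⟩

theorem htL_lt_htL (cs : CoxeterSystem M W) (x y : W) :
    htL cs x < htL cs y ↔ cs.length x < cs.length y := by
  rw [htL, htL, div_lt_div_iff_of_pos_right (by norm_num), Nat.cast_lt]

theorem htL_eq_htL (cs : CoxeterSystem M W) (x y : W) :
    htL cs x = htL cs y ↔ cs.length x = cs.length y := by
  simp [htL]

/-- Exchange property of a quasiparabolic class with respect to an element of minimal length. -/
theorem IsQPClass.exchange {cs : CoxeterSystem M W} {θ : W ≃* W} {𝒦 : Set W}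
    (hK : IsTwClass θ 𝒦) (hqp : IsQPClass cs θ 𝒦) {x : W} (hx : x ∈ 𝒦)
    (hmin : ∀ y ∈ 𝒦, cs.length x ≤ cs.length y) (ω : List B) (r : W) (hr : cs.IsReflection r)
    (hlt : cs.length (twConj θ r (twConj θ (cs.wordProd ω) x)) <
      cs.length (twConj θ (cs.wordProd ω) x)) :
    ∃ ω' : List B, ω'.length < ω.length ∧
      twConj θ r (twConj θ (cs.wordProd ω) x) = twConj θ (cs.wordProd ω') x := by
  induction ω generalizing r with
  | nil =>
    rw [wordProd_nil, twConj_one] at hlt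
    exact absurd (hmin _ (hK.twConj_mem hx r)) (not_le.2 hlt)
  | cons i ω ih =>
    set z' := twConj θ (cs.wordProd ω) x with hz'
    set z := twConj θ (cs.wordProd (i :: ω)) x with hz
    have hzz' : z = twConj θ (cs.simple i) z' := by rw [hz, wordProd_cons, twConj_mul]
    have hsz : twConj θ (cs.simple i) z = z' := by rw [hzz', twConj_simple_simple]
    set u := twConj θ r z with hu
    have hru : twConj θ r u = z := by rw [hu, ← twConj_mul, hr.mul_self, twConj_one]
    have hz'mem : z' ∈ 𝒦 := hK.twConj_mem hx _
    have humem : u ∈ 𝒦 := hK.twConj_mem (hK.twConj_mem hx _) _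
    set r' := cs.simple i * r * cs.simple i with hr'
    have hr'refl : cs.IsReflection r' := by simpa using hr.conj (cs.simple i)
    have hr'z' : twConj θ r' z' = twConj θ (cs.simple i) u := by
      rw [hr', twConj_mul, twConj_mul, ← hzz']
    have hu' : u = twConj θ (cs.simple i) (twConj θ r' z') := by
      rw [hr'z', twConj_simple_simple]
    rcases lt_trichotomy (cs.length (twConj θ r' z')) (cs.length z') with h | h | h
    · obtain ⟨ω', hlen, hω'⟩ := ih r' hr'refl h
      exact ⟨i :: ω', by simpa using hlen, by rw [hu', hω', wordProd_cons, twConj_mul]⟩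
    · have := hqp.1 r' hr'refl z' hz'mem ((htL_eq_htL ..).2 h)
      rw [this, ← hzz'] at hu'
      exact absurd hlt (by rw [hu']; exact lt_irrefl _)
    · have := hqp.2 r hr u humem i (by rw [hru]; exact (htL_lt_htL ..).2 hlt)
        (by rw [hru, hsz, ← hr'z']; exact (htL_lt_htL ..).2 h)
      rw [hru] at this
      exact ⟨ω, by simp, by rw [← hz', ← hsz, this, twConj_simple_simple]⟩

/-- An element of minimal length in a quasiparabolic class is unique. -/
theorem IsQPClass.eq_of_length_eq {cs : CoxeterSystem M W} {θ : W ≃* W} {𝒦 : Set W}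
    (hK : IsTwClass θ 𝒦) (hqp : IsQPClass cs θ 𝒦) {x : W} (hx : x ∈ 𝒦)
    (hmin : ∀ y ∈ 𝒦, cs.length x ≤ cs.length y) {y : W} (hy : y ∈ 𝒦)
    (hlen : cs.length y ≤ cs.length x) : y = x := by
  obtain ⟨w, rfl⟩ := hK.exists_twConj_eq hx hy
  obtain ⟨ω, rfl⟩ := cs.wordProd_surjective w
  clear hy
  induction hn : ω.length using Nat.strong_induction_on generalizing ω with
  | _ n ih =>
    cases ω with
    | nil => simp [twConj_one]
    | cons i ω =>
      subst hn
      set z := twConj θ (cs.wordProd ω) x with hz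
      have hzmem : z ∈ 𝒦 := hK.twConj_mem hx _
      have hy : twConj θ (cs.wordProd (i :: ω)) x = twConj θ (cs.simple i) z := by
        rw [wordProd_cons, twConj_mul]
      rw [hy] at hlen ⊢
      rcases (hlen.trans (hmin z hzmem)).lt_or_eq with h | h
      · obtain ⟨ω', hl, hω'⟩ :=
          hqp.exchange hK hx hmin ω _ (cs.isReflection_simple i) h
        rw [← hz] at hω'
        rw [hω'] at hlen ⊢
        exact ih _ (hl.trans (by simp)) ω' hlen rfl
      · have hfix := hqp.1 _ (cs.isReflection_simple i) z hzmem ((htL_eq_htL ..).2 h)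
        rw [hfix] at hlen ⊢
        exact ih _ (by simp) ω hlen rfl

theorem SimpleOnto.exists_map_simple {cs : CoxeterSystem M W} {θ : W ≃* W}
    (hθS : SimpleOnto cs θ) : ∃ σ : B → B, ∀ i, θ (cs.simple i) = cs.simple (σ i) := by
  have h (i : B) : ∃ j, θ (cs.simple i) = cs.simple j := by
    have : θ (cs.simple i) ∈ Set.range cs.simple := by
      rw [← hθS]; exact ⟨_, ⟨i, rfl⟩, rfl⟩
    obtain ⟨j, hj⟩ := this
    exact ⟨j, hj.symm⟩
  choose σ hσ using h
  exact ⟨σ, hσ⟩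

theorem map_wordProd_of_map_simple {cs : CoxeterSystem M W} {θ : W ≃* W} {σ : B → B}
    (hσ : ∀ i, θ (cs.simple i) = cs.simple (σ i)) (ω : List B) :
    θ (cs.wordProd ω) = cs.wordProd (ω.map σ) := by
  induction ω with
  | nil => simp
  | cons i ω ih => simp [wordProd_cons, hσ, ih]

theorem leftInvSeq_map_of_map_simple {cs : CoxeterSystem M W} {θ : W ≃* W} {σ : B → B}
    (hσ : ∀ i, θ (cs.simple i) = cs.simple (σ i)) (ω : List B) :
    cs.leftInvSeq (ω.map σ) = (cs.leftInvSeq ω).map θ := by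
  induction ω with
  | nil => simp [leftInvSeq]
  | cons i ω ih => simp [leftInvSeq, hσ, ih, Function.comp_def]

/-- If every left inversion of `x` is fixed by `t ↦ x·θ(t)·x⁻¹`, then `x` is a twisted
involution: the inversions of the two factors of `x·θ(x)` cancel in pairs. -/
theorem mul_map_eq_one_of_forall_mem_leftInvSeq {cs : CoxeterSystem M W} {θ : W ≃* W}
    (hθS : SimpleOnto cs θ) {ω : List B}
    (h : ∀ t ∈ cs.leftInvSeq ω, twConj θ t (cs.wordProd ω) = cs.wordProd ω) :
    cs.wordProd ω * θ (cs.wordProd ω) = 1 := by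
  obtain ⟨σ, hσ⟩ := hθS.exists_map_simple
  rw [map_wordProd_of_map_simple hσ, ← wordProd_append]
  apply wordProd_eq_one_of_even_count
  intro t
  have hmap : ((cs.leftInvSeq ω).map θ).map (MulAut.conj (cs.wordProd ω)) =
      cs.leftInvSeq ω := by
    rw [List.map_map]
    refine (List.map_congr_left fun r hr => ?_).trans (List.map_id _)
    have := h r hr
    rw [twConj, mul_inv_eq_iff_eq_mul] at this
    simp [← this]
  rw [leftInvSeq_append, leftInvSeq_map_of_map_simple hσ, hmap, List.count_append]
  exact ⟨_, rfl⟩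

theorem SimpleOnto.length_map_le {cs : CoxeterSystem M W} {θ : W ≃* W}
    (hθS : SimpleOnto cs θ) (w : W) : cs.length (θ w) ≤ cs.length w := by
  obtain ⟨σ, hσ⟩ := hθS.exists_map_simple
  obtain ⟨ω, hred, rfl⟩ := cs.exists_isReduced w
  rw [map_wordProd_of_map_simple hσ, hred.eq]
  simpa using cs.length_wordProd_le (ω.map σ)

/-- A cyclic shift moves an initial segment of a reduced word of `x` to its end, so when `x` is the
unique element of minimal length, every initial segment stabilizes it. -/
theorem IsQPClass.twConj_of_mem_leftInvSeq {cs : CoxeterSystem M W} {θ : W ≃* W}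
    (hθS : SimpleOnto cs θ) {𝒦 : Set W} (hK : IsTwClass θ 𝒦) (hqp : IsQPClass cs θ 𝒦)
    {ω : List B} (hred : cs.IsReduced ω) (hx : cs.wordProd ω ∈ 𝒦)
    (hmin : ∀ y ∈ 𝒦, cs.length (cs.wordProd ω) ≤ cs.length y) {t : W}
    (ht : t ∈ cs.leftInvSeq ω) : twConj θ t (cs.wordProd ω) = cs.wordProd ω := by
  have hinv (k : ℕ) :
      twConj θ (cs.wordProd (ω.take k))⁻¹ (cs.wordProd ω) = cs.wordProd ω := by
    refine hqp.eq_of_length_eq hK hx hmin (hK.twConj_mem hx _) ?_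
    have hshift : twConj θ (cs.wordProd (ω.take k))⁻¹ (cs.wordProd ω) =
        cs.wordProd (ω.drop k) * θ (cs.wordProd (ω.take k)) := by
      have hsplit : cs.wordProd ω =
          cs.wordProd (ω.take k) * cs.wordProd (ω.drop k) := by
        rw [← wordProd_append, List.take_append_drop]
      simp [twConj, hsplit]
    rw [hshift, hred.eq]
    calc _ ≤ cs.length (cs.wordProd (ω.drop k)) + cs.length (cs.wordProd (ω.take k)) :=
          (cs.length_mul_le _ _).trans (Nat.add_le_add_left (hθS.length_map_le _) _)
      _ ≤ (ω.drop k).length + (ω.take k).length :=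
          Nat.add_le_add (cs.length_wordProd_le _) (cs.length_wordProd_le _)
      _ = ω.length := by simp; omega
  have hfix (k : ℕ) : twConj θ (cs.wordProd (ω.take k)) (cs.wordProd ω) = cs.wordProd ω := by
    conv_lhs => rw [← hinv k, ← twConj_mul, mul_inv_cancel, twConj_one]
  obtain ⟨k, hk, rfl⟩ := List.getElem_of_mem ht
  have hk' : k < ω.length := by simpa using hk
  have htake : cs.wordProd (ω.take k) * cs.simple ω[k] = cs.wordProd (ω.take (k + 1)) := by
    rw [← List.take_concat_get' ω k hk', wordProd_append, wordProd_singleton]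
  rw [cs.getElem_leftInvSeq ω k hk', htake, twConj_mul, hinv, hfix]

end TwistedConjugation

/-- If `θ` is an involution and `𝒦` is a quasiparabolic `θ`-twisted
conjugacy class, then `θ(x) = x⁻¹` for all `x ∈ 𝒦`. -/
theorem stmt14 (cs : CoxeterSystem M W) (θ : W ≃* W) (hθS : SimpleOnto cs θ)
    (hθ2 : ∀ w : W, θ (θ w) = w) (𝒦 : Set W) (hK : IsTwClass θ 𝒦)
    (hqp : IsQPClass cs θ 𝒦) :
    ∀ x ∈ 𝒦, θ x = x⁻¹ := by
  have hne : 𝒦.Nonempty := by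
    obtain ⟨x₀, rfl⟩ := hK
    exact Set.range_nonempty _
  obtain ⟨x, hx, hmin⟩ : ∃ x ∈ 𝒦, ∀ y ∈ 𝒦, cs.length x ≤ cs.length y :=
    ⟨Function.argminOn cs.length 𝒦 hne, Function.argminOn_mem _ _ _,
      fun _ hy => Function.argminOn_le _ _ hy⟩
  have hinvol : x * θ x = 1 := by
    obtain ⟨ω, hred, rfl⟩ := cs.exists_isReduced x
    exact mul_map_eq_one_of_forall_mem_leftInvSeq hθS fun _ ht =>
      hqp.twConj_of_mem_leftInvSeq hθS hK hred hx hmin ht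
  intro y hy
  obtain ⟨w, rfl⟩ := hK.exists_twConj_eq hx hy
  simp [twConj, hθ2, eq_inv_of_mul_eq_one_right hinvol, mul_assoc]

end
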